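/- Let w be a weight function with decay rate ω, t ∈ ℝ, n ≥ 1 an integer, and fix Δ ∈ (0, ω/2). Let J_{t,n}(λ, μ) be the associated kernel defined for λ, μ in the strip {ζ ∈ ℂ : |Im ζ| < ω/2} with Im λ ≠ −Δ and Im μ ≠ −Δ. Then for every integer m ≥ 1 the cyclic m-fold integrals ∫_{ℝ^m} ∏_{j=1}^m J_{t,n}(ζ_j, ζ_{j+1}) dζ_1 ⋯ dζ_m and ∫_{ℝ^m} ∏_{j=1}^m J_{t,n}(ζ_j + iΔ, ζ_{j+1} + iΔ) dζ_1 ⋯ dζ_m (indices taken modulo m, i.e. ζ_{m+1} := ζ_1) both converge absolutely and are equal. -/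

import Mathlib

open MeasureTheory

/-- The phase `ψ_n(λ, z) = λ^(2n+1)/(2n+1) + z·λ`. -/
noncomputable def psiC (n : ℕ) (lam z : ℂ) : ℂ := lam ^ (2*n+1) / (2*(n:ℂ)+1) + z * lam

/-- The Fourier–Stieltjes transform `F(ζ) = ∫_ℝ e^{izζ}·w'(z) dz`. -/
noncomputable def FwC (w : ℝ → ℝ) (zeta : ℂ) : ℂ :=
  ∫ z : ℝ, Complex.exp (Complex.I * (z:ℂ) * zeta) * ((deriv w z : ℝ) : ℂ)

/-- The kernel
`J_{t,n}(λ, μ) = (1/(2π)²)·exp((i/2)ψ_n(λ,2t) + (i/2)ψ_n(μ,0))·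
  ∫_ℝ exp(−iψ_n(u−iΔ,t))·F(λ−u+iΔ) / ((λ−u+iΔ)(u−iΔ−μ)) du`. -/
noncomputable def Jker (w : ℝ → ℝ) (t : ℝ) (n : ℕ) (Δ : ℝ) (lam mu : ℂ) : ℂ :=
  ((1 / (2*Real.pi)^2 : ℝ) : ℂ) *
    Complex.exp ((Complex.I/2) * psiC n lam ((2*t : ℝ) : ℂ) + (Complex.I/2) * psiC n mu 0) *
    ∫ u : ℝ, Complex.exp (-Complex.I * psiC n ((u:ℂ) - Complex.I * (Δ:ℂ)) ((t:ℝ):ℂ)) *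
        FwC w (lam - (u:ℂ) + Complex.I * (Δ:ℂ)) /
        ((lam - (u:ℂ) + Complex.I * (Δ:ℂ)) * ((u:ℂ) - Complex.I * (Δ:ℂ) - mu))

/-- A parametric integral of holomorphic functions under an integrable bound is holomorphic. -/
theorem differentiableOn_integral_of_dominated {α : Type*} [MeasurableSpace α] {μ : Measure α}
    {U : Set ℂ} (hU : IsOpen U) {F : ℂ → α → ℂ} {bound : α → ℝ}
    (hmeas : ∀ z, AEStronglyMeasurable (F z) μ)
    (hdiff : ∀ a, DifferentiableOn ℂ (fun z => F z a) U)
    (hbound : ∀ a, ∀ z ∈ U, ‖F z a‖ ≤ bound a) (hint : Integrable bound μ) :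
    DifferentiableOn ℂ (fun z => ∫ a, F z a ∂μ) U := by
  intro z hz
  obtain ⟨r, hr, hrU⟩ := Metric.isOpen_iff.1 hU z hz
  have hr2 : 0 < r / 2 := by positivity
  have hder : ∀ a, ∀ x ∈ U, HasDerivAt (fun z => F z a) (deriv (fun z => F z a) x) x :=
    fun a x hx => ((hdiff a).differentiableAt (hU.mem_nhds hx)).hasDerivAt
  refine (hasDerivAt_integral_of_dominated_loc_of_deriv_le
    (F' := fun x a => deriv (fun z => F z a) x) (bound := fun a => bound a / (r / 2))
    (Metric.ball_mem_nhds z hr2) (Filter.Eventually.of_forall hmeas)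
    (hint.mono' (hmeas z) (Filter.Eventually.of_forall fun a => hbound a z hz)) ?_
    (Filter.Eventually.of_forall fun a x hx => ?_) (hint.div_const _)
    (Filter.Eventually.of_forall fun a x hx =>
      hder a x (hrU (Metric.ball_subset_ball (by linarith) hx)))).2.differentiableAt
    |>.differentiableWithinAt
  · refine aestronglyMeasurable_of_tendsto_ae (nhdsWithin (0 : ℂ) {0}ᶜ)
      (f := fun t a => t⁻¹ • (F (z + t) a - F z a))
      (fun t => ((hmeas (z + t)).sub (hmeas z)).const_smul t⁻¹)
      (Filter.Eventually.of_forall fun a => (hder a z hz).tendsto_slope_zero)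
  · have hsub : Metric.closedBall x (r / 2) ⊆ U := fun y hy => hrU <| by
      rw [Metric.mem_ball] at *
      rw [Metric.mem_closedBall] at hy
      linarith [dist_triangle y x z]
    refine Complex.norm_deriv_le_of_forall_mem_sphere_norm_le hr2 ?_
      (fun y hy => hbound a y (hsub (Metric.sphere_subset_closedBall hy)))
    exact ((hdiff a).mono hsub).diffContOnCl_ball subset_rfl

/-- On a horizontal strip in the closed upper half-plane, for large real part, the imaginary part
of `z ^ (2 * n + 1)` is nonnegative and controlled by its real part. -/
theorem exists_odd_pow_re_im_bounds (n : ℕ) (b : ℝ) :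
    ∃ R D : ℝ, 1 ≤ R ∧ 0 ≤ D ∧ ∀ x y : ℝ, R ≤ x ^ 2 → 0 ≤ y → y ≤ b →
      x ^ 2 ≤ x * ((⟨x, y⟩ : ℂ) ^ (2 * n + 1)).re ∧ 0 ≤ ((⟨x, y⟩ : ℂ) ^ (2 * n + 1)).im ∧
      x ^ 2 * ((⟨x, y⟩ : ℂ) ^ (2 * n + 1)).im ≤
        D * y * (x * ((⟨x, y⟩ : ℂ) ^ (2 * n + 1)).re) := by
  induction n with
  | zero =>
    refine ⟨1, 1, le_rfl, zero_le_one, fun x y _ hy _ => ?_⟩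
    simp only [mul_zero, zero_add, pow_one]
    exact ⟨(sq x).le, hy, by nlinarith⟩
  | succ n ih =>
    obtain ⟨R, D, hR, hD, h⟩ := ih
    refine ⟨max R (2 * (b ^ 2 + 2 * D * b ^ 2 + 1)), 2 * (D + 2), le_trans hR (le_max_left _ _),
      by positivity, fun x y hx hy hyb => ?_⟩
    obtain ⟨h1, h2, h3⟩ := h x y ((le_max_left _ _).trans hx) hy hyb
    have hx' := (le_max_right _ _).trans hx
    have hyy : y ^ 2 ≤ b ^ 2 := pow_le_pow_left₀ hy hyb 2
    have hpow : (⟨x, y⟩ : ℂ) ^ (2 * (n + 1) + 1) = ⟨x, y⟩ ^ (2 * n + 1) * ⟨x, y⟩ ^ 2 := by ring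
    rw [hpow]
    generalize (⟨x, y⟩ : ℂ) ^ (2 * n + 1) = w at *
    simp only [sq (⟨x, y⟩ : ℂ), Complex.mul_re, Complex.mul_im]
    set α := x * w.re with hα
    have e1 : x * (w.re * (x * x - y * y) - w.im * (x * y + y * x)) =
        (x ^ 2 - y ^ 2) * α - 2 * y * (x ^ 2 * w.im) := by rw [hα]; ring
    have e2 : w.re * (x * y + y * x) + w.im * (x * x - y * y) =
        (x ^ 2 - y ^ 2) * w.im + 2 * y * α := by rw [hα]; ring
    rw [e1, e2]
    have hα0 : 0 ≤ α := (sq_nonneg x).trans h1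
    have hDy : D * y ^ 2 ≤ D * b ^ 2 := mul_le_mul_of_nonneg_left hyy hD
    have hDb : 0 ≤ D * b ^ 2 := by positivity
    have hb2 : 0 ≤ b ^ 2 := sq_nonneg b
    have key : x ^ 2 * α ≤ 2 * ((x ^ 2 - y ^ 2) * α - 2 * y * (x ^ 2 * w.im)) := by
      have : 2 * y * (x ^ 2 * w.im) ≤ 2 * y * (D * y * α) :=
        mul_le_mul_of_nonneg_left h3 (by positivity)
      have : 0 ≤ (x ^ 2 - 2 * y ^ 2 - 4 * (D * y ^ 2)) * α := mul_nonneg (by linarith) hα0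
      linarith
    refine ⟨?_, ?_, ?_⟩
    · have : 2 * α ≤ x ^ 2 * α := mul_le_mul_of_nonneg_right (by linarith) hα0
      linarith
    · have : 0 ≤ (x ^ 2 - y ^ 2) * w.im := mul_nonneg (by linarith) h2
      positivity
    · have h4 : x ^ 2 * ((x ^ 2 - y ^ 2) * w.im) ≤ x ^ 2 * (D * y * α) := by
        have : (x ^ 2 - y ^ 2) * w.im ≤ x ^ 2 * w.im :=
          mul_le_mul_of_nonneg_right (by linarith [sq_nonneg y]) h2
        exact mul_le_mul_of_nonneg_left (this.trans h3) (sq_nonneg x)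
      have := mul_le_mul_of_nonneg_left key (by positivity : 0 ≤ (D + 2) * y)
      linarith

theorem exists_le_im_odd_pow {n : ℕ} (hn : 1 ≤ n) (b : ℝ) :
    ∃ C : ℝ, ∀ z : ℂ, 0 ≤ z.im → z.im ≤ b → z.im * z.re ^ 2 - C ≤ (z ^ (2 * n + 1)).im := by
  obtain ⟨k, rfl⟩ := Nat.exists_eq_add_of_le' hn
  obtain ⟨R, D, hR, hD, h⟩ := exists_odd_pow_re_im_bounds k b
  set R' := max R (2 * b ^ 2 + 1) with hR'
  have hR'1 : 1 ≤ R' := le_trans hR (le_max_left _ _)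
  have hcomp : IsCompact (Set.Icc (-R') R' ×ℂ Set.Icc 0 b) := isCompact_Icc.reProdIm isCompact_Icc
  obtain ⟨C, hC⟩ := hcomp.exists_bound_of_continuousOn
    (f := fun z : ℂ => z.im * z.re ^ 2 - (z ^ (2 * (k + 1) + 1)).im) (by fun_prop)
  refine ⟨max C 0, fun z hz hzb => ?_⟩
  by_cases hzR : R' ≤ z.re ^ 2
  · obtain ⟨h1, h2, -⟩ := h z.re z.im ((le_max_left _ _).trans hzR) hz hzb
    have hb' : 2 * b ^ 2 + 1 ≤ z.re ^ 2 := (le_max_right _ _).trans hzR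
    have hzz : z.im ^ 2 ≤ b ^ 2 := pow_le_pow_left₀ hz hzb 2
    have hpow : z ^ (2 * (k + 1) + 1) = z ^ (2 * k + 1) * (z * z) := by ring
    rw [hpow]
    change _ ≤ (z.re * (z ^ (2 * k + 1)).re) at h1
    change 0 ≤ (z ^ (2 * k + 1)).im at h2
    simp only [Complex.mul_im, Complex.mul_re]
    have h3 : 0 ≤ (z.re ^ 2 - z.im ^ 2) * (z ^ (2 * k + 1)).im :=
      mul_nonneg (by nlinarith) h2
    have h4 := mul_le_mul_of_nonneg_left h1 hz
    have h5 : 0 ≤ z.im * z.re ^ 2 := by positivity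
    linarith [le_max_right C 0]
  · have hz2 : z.re ^ 2 ≤ R' ^ 2 := by nlinarith
    have hmem := abs_le.1 (abs_le_of_sq_le_sq hz2 (by linarith))
    have := (le_abs_self _).trans (hC z ⟨hmem, hz, hzb⟩)
    linarith [le_max_left C 0]

theorem integrable_exp_neg_mul_abs {c : ℝ} (hc : 0 < c) :
    Integrable (fun x : ℝ => Real.exp (-c * |x|)) := by
  rw [← integrableOn_univ, ← Set.Iic_union_Ioi (a := (0 : ℝ))]
  refine IntegrableOn.union ?_ ?_
  · refine (integrableOn_exp_mul_Iic hc 0).congr_fun (fun x hx => ?_) measurableSet_Iic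
    simp [abs_of_nonpos (Set.mem_Iic.1 hx)]
  · refine (integrableOn_exp_mul_Ioi (neg_neg_of_pos hc) 0).congr_fun (fun x hx => ?_)
      measurableSet_Ioi
    simp [abs_of_pos (Set.mem_Ioi.1 hx)]

theorem integrable_exp_mul_abs_mul_deriv {w : ℝ → ℝ} (hw_diff : Differentiable ℝ w)
    (hw_pos : ∀ x, 0 < deriv w x) {ω x₀ : ℝ}
    (hw_decay : ∀ x : ℝ, x₀ ≤ |x| → deriv w x ≤ Real.exp (-ω * |x|))
    {b : ℝ} (hb : 0 ≤ b) (hbω : b < ω) :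
    Integrable (fun z : ℝ => Real.exp (b * |z|) * deriv w z) := by
  have hloc : IntegrableOn (deriv w) (Set.Ioc (-x₀) x₀) :=
    intervalIntegral.integrableOn_deriv_of_nonneg hw_diff.continuous.continuousOn
      (fun x _ => (hw_diff x).hasDerivAt) (fun x _ => (hw_pos x).le)
  have hind := (integrable_indicator_iff measurableSet_Ioc).2 (hloc.const_mul (Real.exp (b * x₀)))
  refine (hind.add (integrable_exp_neg_mul_abs (sub_pos.2 hbω))).mono'
    ((by fun_prop : Measurable fun z : ℝ => Real.exp (b * |z|)).mul
      (measurable_deriv w)).aestronglyMeasurable (Filter.Eventually.of_forall fun z => ?_)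
  rw [Real.norm_of_nonneg (mul_nonneg (Real.exp_pos _).le (hw_pos z).le), Pi.add_apply]
  by_cases hz : z ∈ Set.Ioc (-x₀) x₀
  · rw [Set.indicator_of_mem hz]
    have hzx : |z| ≤ x₀ := abs_le.2 ⟨hz.1.le, hz.2⟩
    have : Real.exp (b * |z|) * deriv w z ≤ Real.exp (b * x₀) * deriv w z :=
      mul_le_mul_of_nonneg_right (Real.exp_le_exp.2 (mul_le_mul_of_nonneg_left hzx hb))
        (hw_pos z).le
    linarith [Real.exp_pos (-(ω - b) * |z|)]
  · rw [Set.indicator_of_notMem hz, zero_add]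
    have hzx : x₀ ≤ |z| := by
      by_contra! hlt
      exact hz ⟨(abs_lt.1 hlt).1, (abs_lt.1 hlt).2.le⟩
    calc Real.exp (b * |z|) * deriv w z ≤ Real.exp (b * |z|) * Real.exp (-ω * |z|) :=
          mul_le_mul_of_nonneg_left (hw_decay z hzx) (Real.exp_pos _).le
      _ = Real.exp (-(ω - b) * |z|) := by rw [← Real.exp_add]; ring_nf

theorem norm_FwC_integrand_le {w : ℝ → ℝ} (hw_pos : ∀ x, 0 < deriv w x) {b : ℝ} (z : ℝ) {ζ : ℂ}
    (hζ : |ζ.im| ≤ b) :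
    ‖Complex.exp (Complex.I * (z : ℂ) * ζ) * ((deriv w z : ℝ) : ℂ)‖ ≤
      Real.exp (b * |z|) * deriv w z := by
  rw [norm_mul, Complex.norm_real, Real.norm_of_nonneg (hw_pos z).le, Complex.norm_exp]
  refine mul_le_mul_of_nonneg_right (Real.exp_le_exp.2 ?_) (hw_pos z).le
  simp only [Complex.mul_re, Complex.I_re, Complex.ofReal_re, Complex.I_im, Complex.ofReal_im,
    Complex.mul_im]
  calc _ = -(ζ.im * z) := by ring
    _ ≤ |ζ.im * z| := neg_le_abs _
    _ = |ζ.im| * |z| := abs_mul _ _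
    _ ≤ b * |z| := mul_le_mul_of_nonneg_right hζ (abs_nonneg z)

theorem measurable_FwC (w : ℝ → ℝ) : Measurable (FwC w) := by
  have hd := measurable_deriv w
  have h : StronglyMeasurable fun p : ℂ × ℝ =>
      Complex.exp (Complex.I * (p.2 : ℂ) * p.1) * ((deriv w p.2 : ℝ) : ℂ) :=
    Measurable.stronglyMeasurable (by fun_prop)
  exact h.integral_prod_right'.measurable

theorem differentiableOn_FwC {w : ℝ → ℝ} (hw_pos : ∀ x, 0 < deriv w x) {b : ℝ}
    (hint : Integrable (fun z : ℝ => Real.exp (b * |z|) * deriv w z)) :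
    DifferentiableOn ℂ (FwC w) {ζ | |ζ.im| < b} := by
  have hd := measurable_deriv w
  refine differentiableOn_integral_of_dominated (isOpen_lt (by fun_prop) continuous_const)
    (fun ζ => (by fun_prop : Measurable fun z : ℝ =>
      Complex.exp (Complex.I * (z : ℂ) * ζ) * ((deriv w z : ℝ) : ℂ)).aestronglyMeasurable)
    (fun z => by fun_prop) (fun z ζ hζ => norm_FwC_integrand_le hw_pos z (le_of_lt hζ)) hint

theorem norm_FwC_le {w : ℝ → ℝ} (hw_pos : ∀ x, 0 < deriv w x) {b : ℝ}
    (hint : Integrable (fun z : ℝ => Real.exp (b * |z|) * deriv w z)) {ζ : ℂ} (hζ : |ζ.im| ≤ b) :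
    ‖FwC w ζ‖ ≤ ∫ z : ℝ, Real.exp (b * |z|) * deriv w z :=
  norm_integral_le_of_norm_le hint
    (Filter.Eventually.of_forall fun z => norm_FwC_integrand_le hw_pos z hζ)

theorem inv_one_add_abs_add_le (x : ℝ) {σ : ℝ} (hσ : |σ| ≤ 1) :
    (1 + |x + σ|)⁻¹ ≤ 2 * (1 + |x|)⁻¹ := by
  rw [← div_eq_mul_inv, inv_le_comm₀ (by positivity) (by positivity), inv_div,
    div_le_iff₀ two_pos]
  have : |x| ≤ |x + σ| + |σ| := by simpa using abs_sub (x + σ) σ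
  linarith [abs_nonneg (x + σ)]

theorem integrable_sq_inv_one_add_abs : Integrable fun x : ℝ => (1 + |x|)⁻¹ ^ 2 := by
  have h := integrable_one_add_norm (E := ℝ) (μ := volume) (r := 2) (by simp)
  refine h.congr (Filter.Eventually.of_forall fun x => ?_)
  have : (0 : ℝ) < 1 + ‖x‖ := by positivity
  simp only [Real.norm_eq_abs] at *
  rw [Real.rpow_neg this.le, Real.rpow_two, inv_pow]

/-- Cyclic integrals of a kernel which is holomorphic along diagonal translations of a strip and
decays in both variables do not change when all contours are moved simultaneously: the integral
is holomorphic in the translation parameter and invariant under its real part. -/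
theorem cyclic_integrals_translate {J : ℂ → ℂ → ℂ} {b δ C : ℝ} (hC : 0 ≤ C) (hδ : 0 < δ)
    (hmeas : Measurable fun p : ℂ × ℂ => J p.1 p.2)
    (hbound : ∀ lam mu : ℂ, 0 ≤ lam.im → lam.im < b → 0 ≤ mu.im → mu.im < b →
      ‖J lam mu‖ ≤ C * ((1 + |lam.re|)⁻¹ * (1 + |mu.re|)⁻¹))
    (hdiff : ∀ x y : ℝ, DifferentiableOn ℂ (fun s : ℂ => J (x + s) (y + s))
      {s | -δ < s.im ∧ s.im < b})
    {Δ : ℝ} (hΔ : 0 < Δ) (hΔb : Δ < b) (m : ℕ) [NeZero m] :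
    Integrable (fun ζ : Fin m → ℝ => ∏ j : Fin m, J (ζ j : ℂ) (ζ (j + 1) : ℂ))
    ∧ Integrable (fun ζ : Fin m → ℝ => ∏ j : Fin m,
        J ((ζ j : ℂ) + Complex.I * (Δ : ℂ)) ((ζ (j + 1) : ℂ) + Complex.I * (Δ : ℂ)))
    ∧ (∫ ζ : Fin m → ℝ, ∏ j : Fin m, J (ζ j : ℂ) (ζ (j + 1) : ℂ))
        = ∫ ζ : Fin m → ℝ, ∏ j : Fin m,
          J ((ζ j : ℂ) + Complex.I * (Δ : ℂ)) ((ζ (j + 1) : ℂ) + Complex.I * (Δ : ℂ)) := by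
  set G : ℂ → (Fin m → ℝ) → ℂ := fun s ζ =>
    ∏ j : Fin m, J ((ζ j : ℂ) + s) ((ζ (j + 1) : ℂ) + s) with hG
  have hG0 : (fun ζ : Fin m → ℝ => ∏ j : Fin m, J (ζ j : ℂ) (ζ (j + 1) : ℂ)) = G 0 := by
    simp [hG]
  rw [hG0]
  change Integrable (G 0) ∧ Integrable (G (Complex.I * Δ)) ∧
    (∫ ζ, G 0 ζ) = ∫ ζ, G (Complex.I * Δ) ζ
  have hGmeas : ∀ s, AEStronglyMeasurable (G s) := fun s => by
    refine Measurable.aestronglyMeasurable (Finset.measurable_prod _ fun j _ => ?_)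
    exact hmeas.comp (by fun_prop :
      Measurable fun ζ : Fin m → ℝ => ((ζ j : ℂ) + s, (ζ (j + 1) : ℂ) + s))
  set B : (Fin m → ℝ) → ℝ := fun ζ => ∏ j : Fin m, (4 * C * (1 + |ζ j|)⁻¹ ^ 2) with hB
  have hBint : Integrable B :=
    Integrable.fintype_prod (f := fun _ x => 4 * C * (1 + |x|)⁻¹ ^ 2)
      fun _ => integrable_sq_inv_one_add_abs.const_mul _
  have hGB : ∀ (ζ : Fin m → ℝ) (s : ℂ), 0 ≤ s.im → s.im < b → |s.re| ≤ 1 → ‖G s ζ‖ ≤ B ζ := by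
    intro ζ s hs0 hsb hsr
    have hshift : ∏ j : Fin m, (1 + |ζ (j + 1)|)⁻¹ = ∏ j : Fin m, (1 + |ζ j|)⁻¹ :=
      Equiv.prod_comp (Equiv.addRight (1 : Fin m)) fun j => (1 + |ζ j|)⁻¹
    have hB' : B ζ = ∏ j : Fin m, (4 * C * ((1 + |ζ j|)⁻¹ * (1 + |ζ (j + 1)|)⁻¹)) := by
      simp only [hB, Finset.prod_mul_distrib, hshift, sq]
    rw [hB', hG, norm_prod]
    refine Finset.prod_le_prod (fun _ _ => norm_nonneg _) fun j _ => ?_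
    refine (hbound _ _ (by simpa) (by simpa) (by simpa) (by simpa)).trans ?_
    have h1 := inv_one_add_abs_add_le (ζ j) hsr
    have h2 := inv_one_add_abs_add_le (ζ (j + 1)) hsr
    simp only [Complex.add_re, Complex.ofReal_re]
    calc C * ((1 + |ζ j + s.re|)⁻¹ * (1 + |ζ (j + 1) + s.re|)⁻¹)
        ≤ C * ((2 * (1 + |ζ j|)⁻¹) * (2 * (1 + |ζ (j + 1)|)⁻¹)) := by gcongr
      _ = _ := by ring
  have hGint : ∀ s : ℂ, 0 ≤ s.im → s.im < b → |s.re| ≤ 1 → Integrable (G s) := fun s h1 h2 h3 =>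
    hBint.mono' (hGmeas s) (Filter.Eventually.of_forall fun ζ => hGB ζ s h1 h2 h3)
  refine ⟨hGint 0 (by simp) (by simpa using hΔ.trans hΔb) (by simp),
    hGint _ (by simpa using hΔ.le) (by simpa) (by simp), ?_⟩
  have hGdiff : ∀ ζ, DifferentiableOn ℂ (fun s => G s ζ) {s | -δ < s.im ∧ s.im < b} := fun ζ =>
    DifferentiableOn.fun_finsetProd fun j _ => hdiff (ζ j) (ζ (j + 1))
  set f : ℂ → ℂ := fun s => ∫ ζ, G s ζ with hf
  set U : Set ℂ := Set.Ioo (-1) 1 ×ℂ Set.Ioo 0 b with hU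
  have hUopen : IsOpen U := isOpen_Ioo.reProdIm isOpen_Ioo
  have hUconv : Convex ℝ U := ((convex_Ioo _ _).is_linear_preimage Complex.reLm.isLinear).inter
    ((convex_Ioo _ _).is_linear_preimage Complex.imLm.isLinear)
  have hfdiff : DifferentiableOn ℂ f U :=
    differentiableOn_integral_of_dominated hUopen hGmeas
      (fun ζ => (hGdiff ζ).mono fun s hs => ⟨by linarith [hs.2.1], hs.2.2⟩)
      (fun ζ s hs => hGB ζ s hs.2.1.le hs.2.2 (abs_le.2 ⟨hs.1.1.le, hs.1.2.le⟩)) hBint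
  have hftrans : ∀ (s : ℂ) (a : ℝ), f (s + a) = f s := fun s a => by
    rw [hf]
    dsimp only
    rw [← integral_add_right_eq_self (G s) (fun _ => a)]
    congr 1
    ext ζ
    simp only [hG, Pi.add_apply, Complex.ofReal_add]
    exact Finset.prod_congr rfl fun j _ => by ring_nf
  have hfderiv : U.EqOn (deriv f) 0 := fun s hs => by
    have h1 : HasDerivAt f (deriv f s) (s + ((0 : ℝ) : ℂ)) := by
      simpa using (hfdiff.differentiableAt (hUopen.mem_nhds hs)).hasDerivAt
    have h2 : HasDerivAt (fun a : ℝ => s + (a : ℂ)) 1 0 :=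
      (Complex.ofRealCLM.hasDerivAt (x := (0 : ℝ))).const_add s
    have h3 := h1.comp (0 : ℝ) h2
    have h4 : (f ∘ fun a : ℝ => s + (a : ℂ)) = fun _ => f s := funext fun a => hftrans s a
    rw [h4] at h3
    simpa using h3.unique (hasDerivAt_const (0 : ℝ) (f s))
  have hmem : ∀ y : ℝ, 0 < y → y < b → Complex.I * (y : ℂ) ∈ U := fun y h0 h1 => by
    simp [hU, Complex.mem_reProdIm, h0, h1]
  have hconst : ∀ y : ℝ, 0 < y → y < b → f (Complex.I * y) = f (Complex.I * Δ) :=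
    fun y h0 h1 => hUopen.is_const_of_deriv_eq_zero hUconv.isPreconnected hfdiff hfderiv
      (hmem y h0 h1) (hmem Δ hΔ hΔb)
  have hev : ∀ᶠ y : ℝ in nhdsWithin 0 (Set.Ioi 0), 0 < y ∧ y < b :=
    Ioo_mem_nhdsGT (hΔ.trans hΔb)
  have hcont : ContinuousWithinAt (fun y : ℝ => f (Complex.I * y)) (Set.Ioi 0) 0 := by
    refine continuousWithinAt_of_dominated (Filter.Eventually.of_forall fun y => hGmeas _)
      (hev.mono fun y hy => Filter.Eventually.of_forall fun ζ =>
        hGB ζ _ (by simpa using hy.1.le) (by simpa using hy.2) (by simp)) hBint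
      (Filter.Eventually.of_forall fun ζ => ContinuousAt.continuousWithinAt ?_)
    have hopen : IsOpen {s : ℂ | -δ < s.im ∧ s.im < b} :=
      (isOpen_lt continuous_const Complex.continuous_im).inter
        (isOpen_lt Complex.continuous_im continuous_const)
    have h0 : ContinuousAt (fun s => G s ζ) (Complex.I * ((0 : ℝ) : ℂ)) :=
      ((hGdiff ζ).differentiableAt (hopen.mem_nhds
        (by simpa using And.intro hδ (hΔ.trans hΔb)))).continuousAt
    exact h0.comp (f := fun y : ℝ => Complex.I * (y : ℂ)) (by fun_prop)
  have hlim : Filter.Tendsto (fun y : ℝ => f (Complex.I * y)) (nhdsWithin 0 (Set.Ioi 0))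
      (nhds (f (Complex.I * Δ))) :=
    tendsto_const_nhds.congr' (hev.mono fun y hy => (hconst y hy.1 hy.2).symm)
  simpa using tendsto_nhds_unique hcont hlim

theorem im_psiC (n : ℕ) (lam : ℂ) (z : ℝ) :
    (psiC n lam z).im = (lam ^ (2 * n + 1)).im / (2 * n + 1) + z * lam.im := by
  have h : (2 * (n : ℂ) + 1) = ((2 * n + 1 : ℝ) : ℂ) := by push_cast; rfl
  rw [psiC, h, Complex.add_im, Complex.div_ofReal_im, Complex.im_ofReal_mul]

/-- Below the real axis the phase factor has Gaussian decay. -/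
theorem exists_norm_exp_psiC_le (t : ℝ) {n : ℕ} (hn : 1 ≤ n) {Δ : ℝ} (hΔ : 0 < Δ) :
    ∃ A c : ℝ, 0 ≤ A ∧ 0 < c ∧ ∀ u : ℝ,
      ‖Complex.exp (-Complex.I * psiC n ((u : ℂ) - Complex.I * (Δ : ℂ)) (t : ℂ))‖ ≤
        A * Real.exp (-c * u ^ 2) := by
  obtain ⟨C, hC⟩ := exists_le_im_odd_pow hn Δ
  have hN : (0 : ℝ) < 2 * n + 1 := by positivity
  refine ⟨Real.exp (C / (2 * n + 1) - t * Δ), Δ / (2 * n + 1), (Real.exp_pos _).le,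
    by positivity, fun u => ?_⟩
  have hconj : (u : ℂ) - Complex.I * (Δ : ℂ) =
      (starRingEnd ℂ) ((u : ℂ) + Complex.I * (Δ : ℂ)) := by
    simp [sub_eq_add_neg]
  have him : (-Complex.I * psiC n ((u : ℂ) - Complex.I * (Δ : ℂ)) (t : ℂ)).re =
      (psiC n ((u : ℂ) - Complex.I * (Δ : ℂ)) (t : ℂ)).im := by simp
  have h := hC ((u : ℂ) + Complex.I * (Δ : ℂ)) (by simpa using hΔ.le) (by simp)
  rw [Complex.norm_exp, him, im_psiC, hconj, ← map_pow, Complex.conj_im, Complex.conj_im,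
    ← Real.exp_add, Real.exp_le_exp]
  generalize (((u : ℂ) + Complex.I * (Δ : ℂ)) ^ (2 * n + 1)).im = y at h
  have h' : Δ * u ^ 2 - C ≤ y := by simpa using h
  have h3 : -y / (2 * n + 1) ≤ (C - Δ * u ^ 2) / (2 * n + 1) :=
    div_le_div_of_nonneg_right (by linarith) hN.le
  have h4 : (C - Δ * u ^ 2) / (2 * n + 1) =
      C / (2 * n + 1) + -(Δ / (2 * n + 1)) * u ^ 2 := by ring
  have h5 : ((u : ℂ) + Complex.I * (Δ : ℂ)).im = Δ := by simp
  rw [h5]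
  linarith

/-- Above the real axis the half phases are bounded on strips. -/
theorem exists_norm_exp_half_psiC_le (t : ℝ) {n : ℕ} (hn : 1 ≤ n) {b : ℝ} :
    ∃ A : ℝ, 0 ≤ A ∧ ∀ lam mu : ℂ, 0 ≤ lam.im → lam.im < b → 0 ≤ mu.im → mu.im < b →
      ‖Complex.exp ((Complex.I / 2) * psiC n lam ((2 * t : ℝ) : ℂ) +
        (Complex.I / 2) * psiC n mu 0)‖ ≤ A := by
  obtain ⟨C, hC⟩ := exists_le_im_odd_pow hn b
  have hN : (0 : ℝ) < 2 * n + 1 := by positivity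
  refine ⟨Real.exp (C / (2 * n + 1) + |t| * b), (Real.exp_pos _).le,
    fun lam mu hl hlb hm hmb => ?_⟩
  have hre : ((Complex.I / 2) * psiC n lam ((2 * t : ℝ) : ℂ) + (Complex.I / 2) * psiC n mu 0).re
      = -(psiC n lam ((2 * t : ℝ) : ℂ)).im / 2 - (psiC n mu ((0 : ℝ) : ℂ)).im / 2 := by
    rw [show Complex.I / 2 = ((1 / 2 : ℝ) : ℂ) * Complex.I by push_cast; ring, mul_assoc,
      mul_assoc, Complex.add_re, Complex.re_ofReal_mul, Complex.re_ofReal_mul, Complex.I_mul_re,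
      Complex.I_mul_re, Complex.ofReal_zero]
    ring
  have key : ∀ z : ℂ, 0 ≤ z.im → z.im ≤ b →
      -(C / (2 * n + 1)) ≤ (z ^ (2 * n + 1)).im / (2 * n + 1) := fun z h1 h2 => by
    rw [← neg_div]
    refine div_le_div_of_nonneg_right ?_ hN.le
    have := mul_nonneg h1 (sq_nonneg z.re)
    linarith [hC z h1 h2]
  rw [Complex.norm_exp, hre, im_psiC, im_psiC, Real.exp_le_exp]
  have h1 := key lam hl hlb.le
  have h2 := key mu hm hmb.le
  have h3 : -(t * lam.im) ≤ |t| * b := by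
    calc -(t * lam.im) ≤ |t * lam.im| := neg_le_abs _
      _ = |t| * lam.im := by rw [abs_mul, abs_of_nonneg hl]
      _ ≤ |t| * b := mul_le_mul_of_nonneg_left hlb.le (abs_nonneg t)
  linarith

theorem inv_norm_le_of_le_abs_im {z : ℂ} {δ a u : ℝ} (hδ : 0 < δ) (him : δ ≤ |z.im|)
    (hre : |a| ≤ |z.re| + |u|) :
    ‖z‖⁻¹ ≤ (1 + δ⁻¹) * (1 + |u|) * (1 + |a|)⁻¹ := by
  have hz : δ ≤ ‖z‖ := him.trans (Complex.abs_im_le_norm z)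
  have hz0 : 0 < ‖z‖ := hδ.trans_le hz
  have h1 : 1 ≤ δ⁻¹ * ‖z‖ := by rwa [← div_eq_inv_mul, one_le_div hδ]
  have h2 : |z.re| ≤ ‖z‖ := Complex.abs_re_le_norm z
  have ha : 0 < 1 + |a| := by positivity
  rw [← div_eq_mul_inv, le_div_iff₀ ha, inv_mul_le_iff₀ hz0]
  calc 1 + |a| ≤ 1 + (‖z‖ + |u|) := by linarith
    _ ≤ (1 + ‖z‖) * (1 + |u|) := by nlinarith [abs_nonneg u]
    _ ≤ (δ⁻¹ * ‖z‖ + ‖z‖) * (1 + |u|) := by gcongr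
    _ = _ := by ring

theorem integrable_exp_neg_mul_sq_mul_sq {c : ℝ} (hc : 0 < c) :
    Integrable fun u : ℝ => Real.exp (-c * u ^ 2) * (1 + |u|) ^ 2 := by
  have h1 := integrable_exp_neg_mul_sq hc
  have h2 : Integrable fun u : ℝ => u ^ 2 * Real.exp (-c * u ^ 2) := by
    simpa using integrable_rpow_mul_exp_neg_mul_sq hc (s := 2) (by norm_num)
  refine ((h1.const_mul 2).add (h2.const_mul 2)).mono'
    (by fun_prop : Continuous _).aestronglyMeasurable (Filter.Eventually.of_forall fun u => ?_)
  rw [Real.norm_of_nonneg (by positivity)]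
  have : (1 + |u|) ^ 2 ≤ 2 + 2 * u ^ 2 := by nlinarith [sq_nonneg (1 - |u|), sq_abs u]
  simp only [Pi.add_apply]
  nlinarith [Real.exp_pos (-c * u ^ 2)]

/-- The integrand of the contour integral defining `Jker`. -/
noncomputable def JkerIntegrand (w : ℝ → ℝ) (t : ℝ) (n : ℕ) (Δ : ℝ) (lam mu : ℂ) (u : ℝ) : ℂ :=
  Complex.exp (-Complex.I * psiC n ((u:ℂ) - Complex.I * (Δ:ℂ)) ((t:ℝ):ℂ)) *
    FwC w (lam - (u:ℂ) + Complex.I * (Δ:ℂ)) /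
    ((lam - (u:ℂ) + Complex.I * (Δ:ℂ)) * ((u:ℂ) - Complex.I * (Δ:ℂ) - mu))

theorem measurable_JkerIntegrand (w : ℝ → ℝ) (t : ℝ) (n : ℕ) (Δ : ℝ) :
    Measurable fun p : (ℂ × ℂ) × ℝ => JkerIntegrand w t n Δ p.1.1 p.1.2 p.2 := by
  have hF := measurable_FwC w
  unfold JkerIntegrand psiC
  fun_prop

theorem measurable_Jker (w : ℝ → ℝ) (t : ℝ) (n : ℕ) (Δ : ℝ) :
    Measurable fun p : ℂ × ℂ => Jker w t n Δ p.1 p.2 := by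
  have h := (measurable_JkerIntegrand w t n Δ).stronglyMeasurable.integral_prod_right'
    (ν := volume).measurable
  refine Measurable.mul ?_ h
  unfold psiC
  fun_prop

/-- A uniform bound for the integrand, valid a little below the real axis. -/
theorem exists_norm_JkerIntegrand_le {w : ℝ → ℝ} (hw_pos : ∀ x, 0 < deriv w x) (t : ℝ) {n : ℕ}
    (hn : 1 ≤ n) {Δ b : ℝ} (hΔ : 0 < Δ)
    (hint : Integrable (fun z : ℝ => Real.exp ((b + Δ) * |z|) * deriv w z)) :
    ∃ K c : ℝ, 0 ≤ K ∧ 0 < c ∧ ∀ (lam mu : ℂ) (u : ℝ), -(Δ / 2) < lam.im → lam.im < b →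
      -(Δ / 2) < mu.im → ‖JkerIntegrand w t n Δ lam mu u‖ ≤
        K * (Real.exp (-c * u ^ 2) * (1 + |u|) ^ 2) *
          ((1 + |lam.re|)⁻¹ * (1 + |mu.re|)⁻¹) := by
  obtain ⟨A, c, hA, hc, hexp⟩ := exists_norm_exp_psiC_le t hn hΔ
  set M := ∫ z : ℝ, Real.exp ((b + Δ) * |z|) * deriv w z
  have hM : 0 ≤ M := integral_nonneg fun z => mul_nonneg (Real.exp_pos _).le (hw_pos z).le
  have hδ : 0 < Δ / 2 := by positivity
  refine ⟨A * M * (1 + (Δ / 2)⁻¹) ^ 2, c, by positivity, hc, fun lam mu u hl hlb hm => ?_⟩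
  have hF : ‖FwC w (lam - (u:ℂ) + Complex.I * (Δ:ℂ))‖ ≤ M :=
    norm_FwC_le hw_pos hint (by
      simp only [Complex.add_im, Complex.sub_im, Complex.ofReal_im, Complex.I_mul_im,
        Complex.ofReal_re]
      exact abs_le.2 ⟨by linarith, by linarith⟩)
  have h1 : ‖lam - (u:ℂ) + Complex.I * (Δ:ℂ)‖⁻¹ ≤
      (1 + (Δ / 2)⁻¹) * (1 + |u|) * (1 + |lam.re|)⁻¹ := by
    refine inv_norm_le_of_le_abs_im hδ (le_abs.2 (Or.inl ?_)) ?_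
    · simp; linarith
    · simpa using abs_add_le (lam.re - u) u
  have h2 : ‖(u:ℂ) - Complex.I * (Δ:ℂ) - mu‖⁻¹ ≤
      (1 + (Δ / 2)⁻¹) * (1 + |u|) * (1 + |mu.re|)⁻¹ := by
    refine inv_norm_le_of_le_abs_im hδ (le_abs.2 (Or.inr ?_)) ?_
    · simp; linarith
    · simpa [abs_sub_comm mu.re u] using abs_add_le (mu.re - u) u
  rw [JkerIntegrand, norm_div, norm_mul, norm_mul, div_eq_mul_inv, mul_inv]
  calc _ ≤ (A * Real.exp (-c * u ^ 2)) * M *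
        (((1 + (Δ / 2)⁻¹) * (1 + |u|) * (1 + |lam.re|)⁻¹) *
          ((1 + (Δ / 2)⁻¹) * (1 + |u|) * (1 + |mu.re|)⁻¹)) := by
        gcongr
        exact hexp u
    _ = _ := by ring

theorem differentiableOn_JkerIntegrand {w : ℝ → ℝ} (hw_pos : ∀ x, 0 < deriv w x) (t : ℝ) (n : ℕ)
    {Δ b : ℝ} (hΔ : 0 < Δ)
    (hint : Integrable (fun z : ℝ => Real.exp ((b + Δ) * |z|) * deriv w z)) (x y u : ℝ) :
    DifferentiableOn ℂ (fun s : ℂ => JkerIntegrand w t n Δ (x + s) (y + s) u)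
      {s | -(Δ / 2) < s.im ∧ s.im < b} := by
  have hF : DifferentiableOn ℂ (fun s : ℂ => FwC w ((x + s) - (u:ℂ) + Complex.I * (Δ:ℂ)))
      {s | -(Δ / 2) < s.im ∧ s.im < b} :=
    (differentiableOn_FwC hw_pos hint).comp (by fun_prop) fun s hs => by
      simp only [Set.mem_ofPred_eq, Complex.add_im, Complex.sub_im, Complex.ofReal_im,
        Complex.I_mul_im, Complex.ofReal_re]
      exact abs_lt.2 ⟨by linarith [hs.1, hs.2], by linarith [hs.2]⟩
  refine DifferentiableOn.div (hF.const_mul _) (by fun_prop) fun s hs => mul_ne_zero ?_ ?_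
  · refine fun h => absurd (congrArg Complex.im h) ?_
    simp only [Complex.add_im, Complex.sub_im, Complex.ofReal_im, Complex.I_mul_im,
      Complex.ofReal_re, Complex.zero_im]
    linarith [hs.1]
  · refine fun h => absurd (congrArg Complex.im h) ?_
    simp only [Complex.add_im, Complex.sub_im, Complex.ofReal_im, Complex.I_mul_im,
      Complex.ofReal_re, Complex.zero_im]
    linarith [hs.1]

theorem exists_norm_Jker_le {w : ℝ → ℝ} (hw_pos : ∀ x, 0 < deriv w x) (t : ℝ) {n : ℕ}
    (hn : 1 ≤ n) {Δ b : ℝ} (hΔ : 0 < Δ)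
    (hint : Integrable (fun z : ℝ => Real.exp ((b + Δ) * |z|) * deriv w z)) :
    ∃ C : ℝ, 0 ≤ C ∧ ∀ lam mu : ℂ, 0 ≤ lam.im → lam.im < b → 0 ≤ mu.im → mu.im < b →
      ‖Jker w t n Δ lam mu‖ ≤ C * ((1 + |lam.re|)⁻¹ * (1 + |mu.re|)⁻¹) := by
  obtain ⟨K, c, hK, hc, hbd⟩ := exists_norm_JkerIntegrand_le hw_pos t hn hΔ hint
  obtain ⟨A, hA, hexp⟩ := exists_norm_exp_half_psiC_le t hn (b := b)
  set L := ∫ u : ℝ, Real.exp (-c * u ^ 2) * (1 + |u|) ^ 2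
  have hL : 0 ≤ L := integral_nonneg fun u => by positivity
  refine ⟨‖((1 / (2*Real.pi)^2 : ℝ) : ℂ)‖ * A * (K * L), by positivity,
    fun lam mu hl hlb hm hmb => ?_⟩
  have hI : ‖∫ u, JkerIntegrand w t n Δ lam mu u‖ ≤
      K * L * ((1 + |lam.re|)⁻¹ * (1 + |mu.re|)⁻¹) := by
    rw [← integral_const_mul, ← integral_mul_const]
    exact norm_integral_le_of_norm_le
      (((integrable_exp_neg_mul_sq_mul_sq hc).const_mul K).mul_const _)
      (Filter.Eventually.of_forall fun u => hbd lam mu u (by linarith) hlb (by linarith))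
  change ‖_ * _ * ∫ u, JkerIntegrand w t n Δ lam mu u‖ ≤ _
  rw [norm_mul, norm_mul]
  calc _ ≤ ‖((1 / (2*Real.pi)^2 : ℝ) : ℂ)‖ * A *
        (K * L * ((1 + |lam.re|)⁻¹ * (1 + |mu.re|)⁻¹)) := by
        gcongr
        exact hexp lam mu hl hlb hm hmb
    _ = _ := by ring

theorem differentiableOn_Jker {w : ℝ → ℝ} (hw_pos : ∀ x, 0 < deriv w x) (t : ℝ) {n : ℕ}
    (hn : 1 ≤ n) {Δ b : ℝ} (hΔ : 0 < Δ)
    (hint : Integrable (fun z : ℝ => Real.exp ((b + Δ) * |z|) * deriv w z)) (x y : ℝ) :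
    DifferentiableOn ℂ (fun s : ℂ => Jker w t n Δ (x + s) (y + s))
      {s | -(Δ / 2) < s.im ∧ s.im < b} := by
  obtain ⟨K, c, hK, hc, hbd⟩ := exists_norm_JkerIntegrand_le hw_pos t hn hΔ hint
  have hopen : IsOpen {s : ℂ | -(Δ / 2) < s.im ∧ s.im < b} :=
    (isOpen_lt continuous_const Complex.continuous_im).inter
      (isOpen_lt Complex.continuous_im continuous_const)
  have hI := differentiableOn_integral_of_dominated hopen
    (F := fun s u => JkerIntegrand w t n Δ (x + s) (y + s) u)
    (fun s => ((measurable_JkerIntegrand w t n Δ).comp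
      (by fun_prop : Measurable fun u : ℝ =>
        (((x : ℂ) + s, (y : ℂ) + s), u))).aestronglyMeasurable)
    (differentiableOn_JkerIntegrand hw_pos t n hΔ hint x y)
    (bound := fun u => K * (Real.exp (-c * u ^ 2) * (1 + |u|) ^ 2))
    (fun u s hs => ?_) ((integrable_exp_neg_mul_sq_mul_sq hc).const_mul K)
  · refine DifferentiableOn.mul ?_ hI
    unfold psiC
    fun_prop
  · refine (hbd _ _ u (by simpa using hs.1) (by simpa using hs.2) (by simpa using hs.1)).trans
      (mul_le_of_le_one_right (by positivity) (mul_le_one₀ ?_ (by positivity) ?_)) <;>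
    exact inv_le_one_of_one_le₀ (le_add_of_nonneg_right (abs_nonneg _))

/-- for every integer `m ≥ 1` the cyclic `m`-fold integrals of the kernel
`J_{t,n}` along `ℝ` and along `ℝ + iΔ` both converge absolutely and are equal. -/
theorem Jker_cyclic_integrals_deform
    (w : ℝ → ℝ) (hw_diff : Differentiable ℝ w)
    (hw_pos : ∀ x, 0 < deriv w x)
    (hw_top : Filter.Tendsto w Filter.atTop (nhds 1))
    (hw_bot : Filter.Tendsto w Filter.atBot (nhds 0))
    (ω x₀ : ℝ) (hω : 0 < ω) (hx₀ : 0 < x₀)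
    (hw_decay : ∀ x : ℝ, x₀ ≤ |x| → deriv w x ≤ Real.exp (-ω * |x|))
    (t : ℝ) (n : ℕ) (hn : 1 ≤ n)
    (Δ : ℝ) (hΔ : 0 < Δ) (hΔω : Δ < ω/2)
    (m : ℕ) [NeZero m] :
    Integrable (fun ζ : Fin m → ℝ =>
      ∏ j : Fin m, Jker w t n Δ ((ζ j : ℝ) : ℂ) ((ζ (j+1) : ℝ) : ℂ))
    ∧ Integrable (fun ζ : Fin m → ℝ =>
      ∏ j : Fin m, Jker w t n Δ (((ζ j : ℝ) : ℂ) + Complex.I * (Δ:ℂ))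
        (((ζ (j+1) : ℝ) : ℂ) + Complex.I * (Δ:ℂ)))
    ∧ (∫ ζ : Fin m → ℝ, ∏ j : Fin m, Jker w t n Δ ((ζ j : ℝ) : ℂ) ((ζ (j+1) : ℝ) : ℂ))
        = ∫ ζ : Fin m → ℝ, ∏ j : Fin m, Jker w t n Δ (((ζ j : ℝ) : ℂ) + Complex.I * (Δ:ℂ))
            (((ζ (j+1) : ℝ) : ℂ) + Complex.I * (Δ:ℂ)) := by
  have hint : Integrable (fun z : ℝ => Real.exp ((ω / 2 + Δ) * |z|) * deriv w z) :=
    integrable_exp_mul_abs_mul_deriv hw_diff hw_pos hw_decay (by positivity) (by linarith)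
  obtain ⟨C, hC, hbound⟩ := exists_norm_Jker_le hw_pos t hn hΔ hint
  exact cyclic_integrals_translate hC (half_pos hΔ) (measurable_Jker w t n Δ) hbound
    (differentiableOn_Jker hw_pos t hn hΔ hint) hΔ hΔω m
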